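/- Let R be a finite commutative local Frobenius ring with maximal ideal m, residue field F_q = R/m, and socle soc(R) = αR. Let H ≤ GL_k(F_q) be a subgroup that is closed under the right action of GL_k(F_q) on the orbit space O. Then there exist n ∈ ℕ and a stabilizer code C ⊆ R^{2n} such that C ⊆ (αR)^{2n}, C is a k-dimensional F_q-vector space (with scalar multiplication r̄·x = rx) spanned over F_q by the rows of a matrix G' with entries in αR, and the group {B ∈ GL_k(F_q) : wt_s(xBG') = wt_s(xG') for all x} of symplectic isometries of C equals H. -/

import Mathlib

open Matrix

/-- A generating character of a finite commutative ring; `R` is Frobenius iff one exists. -/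
def IsGenChar {R : Type*} [CommRing R] [Fintype R] (χ : AddChar R ℂ) : Prop :=
  ∀ ψ : AddChar R ℂ, ∃ r : R, ∀ v : R, ψ v = χ (v * r)

/-- Symplectic weight of a vector of `R^{2n}`, written in the `γ`-coordinates `(R²)^n`. -/
def wtH {R : Type*} [CommRing R] [DecidableEq R] {ι : Type*} [Fintype ι]
    (v : ι × Fin 2 → R) : ℕ :=
  (Finset.univ.filter fun i : ι =>
    ¬(v (i, (0 : Fin 2)) = 0 ∧ v (i, (1 : Fin 2)) = 0)).card

/-- The symplectic form on `R^{2n}`, written in the `γ`-coordinates `(R²)^n`. -/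
def sympFormI {R : Type*} [CommRing R] {ι : Type*} [Fintype ι]
    (v w : ι × Fin 2 → R) : R :=
  ∑ i : ι, (v (i, (1 : Fin 2)) * w (i, (0 : Fin 2)) -
            v (i, (0 : Fin 2)) * w (i, (1 : Fin 2)))

/-- `Hs ⊆ GL_k(K)` is closed with respect to the right action of `GL_k(K)` on the orbit
space `O` of the scalar `Kˣ`-action on `K^k`. -/
def ClosedO {K : Type*} [CommRing K] {k : ℕ}
    (Hs : Set (Matrix.GeneralLinearGroup (Fin k) K)) : Prop :=
  ∀ g : Matrix.GeneralLinearGroup (Fin k) K,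
    (∀ x : Fin k → K,
      {y : Fin k → K | ∃ B ∈ Hs, ∃ u : Kˣ,
        y = (u : K) • Matrix.vecMul x
          ((B : Matrix (Fin k) (Fin k) K) * (g : Matrix (Fin k) (Fin k) K))} =
      {y : Fin k → K | ∃ B ∈ Hs, ∃ u : Kˣ,
        y = (u : K) • Matrix.vecMul x (B : Matrix (Fin k) (Fin k) K)})
    ↔ g ∈ Hs

section Counting

variable {K : Type*} [Field K] {k : ℕ}

theorem card_preimage_mul_card {V W : Type*} [AddCommGroup V] [AddCommGroup W] [Fintype V]
    [Fintype W] [DecidableEq W] (f : V →+ W) (hf : Function.Surjective f)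
    (P : W → Prop) [DecidablePred P] :
    (Finset.univ.filter fun c => P (f c)).card * Fintype.card W =
      (Finset.univ.filter P).card * Fintype.card V := by
  have hfib : ∀ w : W, (Finset.univ.filter fun c => f c = w).card =
      (Finset.univ.filter fun c => f c = 0).card := fun w =>
    AddMonoidHom.card_fiber_eq_of_mem_range f (hf w) (hf 0)
  have hcount : ∀ S : Finset W, (Finset.univ.filter fun c => f c ∈ S).card =
      S.card * (Finset.univ.filter fun c => f c = 0).card := by
    intro S
    rw [Finset.card_eq_sum_card_fiberwise (f := f) (t := S) (by intro c hc; simpa using hc),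
      ← smul_eq_mul, ← Finset.sum_const]
    refine Finset.sum_congr rfl fun w hw => ?_
    rw [← hfib w, Finset.filter_filter]
    congr 1
    ext c
    simp only [Finset.mem_filter, Finset.mem_univ, true_and]
    exact ⟨fun h => h.2, fun h => ⟨h ▸ hw, h⟩⟩
  have h1 := hcount (Finset.univ.filter P)
  have h2 := hcount Finset.univ
  simp only [Finset.mem_filter, Finset.mem_univ, true_and, Finset.filter_true,
    Finset.card_univ] at h1 h2
  rw [h1, h2]
  ring

theorem exists_dotProduct_ne_zero {x : Fin k → K} (hx : x ≠ 0) : ∃ c, x ⬝ᵥ c ≠ 0 := by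
  by_contra! h
  exact hx (dotProduct_eq_zero x h)

theorem exists_dotProduct_eq_zero_ne_zero {x y : Fin k → K} (hx : x ≠ 0)
    (hxy : ∀ a : K, y ≠ a • x) : ∃ c, x ⬝ᵥ c = 0 ∧ y ⬝ᵥ c ≠ 0 := by
  obtain ⟨i, hi⟩ : ∃ i, x i ≠ 0 := by
    by_contra! h
    exact hx (funext h)
  obtain ⟨j, hj⟩ : ∃ j, y j ≠ ((y i / x i) • x) j := by
    by_contra! h
    exact hxy _ (funext h)
  refine ⟨x i • Pi.single j 1 - x j • Pi.single i 1, ?_, ?_⟩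
  · simp [dotProduct_sub, mul_comm]
  · simp only [dotProduct_sub, dotProduct_smul, dotProduct_single, smul_eq_mul, mul_one]
    intro h
    apply hj
    simp only [Pi.smul_apply, smul_eq_mul]
    field_simp
    linear_combination h

/-- The number of columns `c` that are orthogonal neither to `x` nor to `y`. -/
def commonSupport [Fintype K] [DecidableEq K] (x y : Fin k → K) : ℕ :=
  (Finset.univ.filter fun c : Fin k → K => x ⬝ᵥ c ≠ 0 ∧ y ⬝ᵥ c ≠ 0).card

variable [Fintype K] [DecidableEq K]

theorem commonSupport_smul {x : Fin k → K} (hx : x ≠ 0) (u : Kˣ) :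
    commonSupport x ((u : K) • x) * Fintype.card K =
      (Fintype.card K - 1) * Fintype.card (Fin k → K) := by
  have hs : Function.Surjective (dotProductBilin K K x).toAddMonoidHom := by
    obtain ⟨c, hc⟩ := exists_dotProduct_ne_zero hx
    intro a
    refine ⟨(a / (x ⬝ᵥ c)) • c, ?_⟩
    simp [hc]
  have h := card_preimage_mul_card _ hs (fun a => a ≠ 0)
  have h0 : (Finset.univ.filter fun a : K => a ≠ 0).card = Fintype.card K - 1 := by
    rw [Finset.filter_ne', Finset.card_erase_of_mem (Finset.mem_univ _), Finset.card_univ]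
  rw [h0] at h
  rw [← h, commonSupport]
  congr 2
  ext c
  simp

theorem commonSupport_of_ne_smul {x y : Fin k → K} (hx : x ≠ 0) (hy : y ≠ 0)
    (hxy : ∀ u : Kˣ, y ≠ (u : K) • x) :
    commonSupport x y * (Fintype.card K * Fintype.card K) =
      (Fintype.card K - 1) * (Fintype.card K - 1) * Fintype.card (Fin k → K) := by
  have hxy' : ∀ a : K, y ≠ a • x := by
    intro a
    rcases eq_or_ne a 0 with rfl | ha
    · simpa using hy
    · exact hxy (Units.mk0 a ha)
  have hs : Function.Surjective
      ((dotProductBilin K K x).prod (dotProductBilin K K y)).toAddMonoidHom := by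
    obtain ⟨c, hc⟩ := exists_dotProduct_ne_zero hx
    obtain ⟨d, hd0, hd⟩ := exists_dotProduct_eq_zero_ne_zero hx hxy'
    rintro ⟨a, b⟩
    refine ⟨(a / (x ⬝ᵥ c)) • c + ((b - a / (x ⬝ᵥ c) * (y ⬝ᵥ c)) / (y ⬝ᵥ d)) • d, ?_⟩
    simp [hc, hd0, hd]
  have h := card_preimage_mul_card _ hs (fun a => a.1 ≠ 0 ∧ a.2 ≠ 0)
  have h0 : (Finset.univ.filter fun a : K × K => a.1 ≠ 0 ∧ a.2 ≠ 0).card =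
      (Fintype.card K - 1) * (Fintype.card K - 1) := by
    rw [← Finset.univ_product_univ,
      Finset.filter_product (fun a : K => a ≠ 0) (fun a : K => a ≠ 0), Finset.card_product,
      Finset.filter_ne', Finset.card_erase_of_mem (Finset.mem_univ _), Finset.card_univ]
  rw [h0, Fintype.card_prod] at h
  rw [← h, commonSupport]
  congr 2

theorem sum_commonSupport (f : (Fin k → K) → ℕ)
    (hf : ∀ (u : Kˣ) (x : Fin k → K), f ((u : K) • x) = f x) :
    ∃ A D : ℕ, 0 < D ∧ ∀ x : Fin k → K, x ≠ 0 →
      (∑ y, f y * commonSupport x y) * (Fintype.card K * Fintype.card K) = A + D * f x := by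
  classical
  set q := Fintype.card K with hq
  set Q := Fintype.card (Fin k → K) with hQ
  have hq1 : 1 < q := Fintype.one_lt_card
  obtain ⟨p, hp⟩ : ∃ p, q = p + 1 := ⟨q - 1, by omega⟩
  refine ⟨∑ y, f y * (if y ≠ 0 then p * p * Q else 0), p * Q * Fintype.card Kˣ,
    Nat.mul_pos (Nat.mul_pos (by omega) Fintype.card_pos) Fintype.card_pos, fun x hx => ?_⟩
  have key : ∀ y, commonSupport x y * (q * q) =
      (if y ≠ 0 then p * p * Q else 0) + ∑ u : Kˣ, if (u : K) • x = y then p * Q else 0 := by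
    intro y
    rcases eq_or_ne y 0 with rfl | hy
    · simp [commonSupport, hx]
    · by_cases h : ∃ u : Kˣ, y = (u : K) • x
      · obtain ⟨u, rfl⟩ := h
        have h1 := commonSupport_smul hx u
        have h2 : ∀ v : Kˣ, (v : K) • x = (u : K) • x ↔ v = u := by
          intro v
          rw [smul_left_inj hx, Units.val_inj]
        simp only [h2, hy, ne_eq, not_false_eq_true, if_true, Finset.sum_ite_eq', Finset.mem_univ]
        rw [← mul_assoc, h1, ← hq, ← hQ, hp, Nat.add_sub_cancel]
        ring
      · push Not at h
        have h1 := commonSupport_of_ne_smul hx hy h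
        rw [h1, ← hq, ← hQ, hp, Nat.add_sub_cancel, if_pos hy, Finset.sum_eq_zero, add_zero]
        exact fun u _ => if_neg fun h' => h u h'.symm
  simp only [Finset.sum_mul, mul_assoc (f _), key, mul_add, Finset.sum_add_distrib]
  congr 1
  simp only [Finset.mul_sum]
  rw [Finset.sum_comm]
  simp only [mul_ite, mul_zero, Finset.sum_ite_eq, Finset.mem_univ, if_true, hf,
    Finset.sum_const, Finset.card_univ, smul_eq_mul]
  ring

theorem exists_hammingNorm_vecMul (f : (Fin k → K) → ℕ) :
    ∃ (n : ℕ) (g : Matrix (Fin k) (Fin n) K), ∀ x : Fin k → K,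
      hammingNorm (x ᵥ* g) = ∑ y, f y * commonSupport x y := by
  let ι := Σ y : Fin k → K, Fin (f y) × (Fin k → K)
  let e : ι ≃ Fin (Fintype.card ι) := Fintype.equivFin ι
  let g : Matrix (Fin k) ι K := fun i a => if a.1 ⬝ᵥ a.2.2 ≠ 0 then a.2.2 i else 0
  refine ⟨Fintype.card ι, g.submatrix id e.symm, fun x => ?_⟩
  have hg : ∀ a : ι, (x ᵥ* g) a = if a.1 ⬝ᵥ a.2.2 ≠ 0 then x ⬝ᵥ a.2.2 else 0 := by
    intro a
    by_cases h : a.1 ⬝ᵥ a.2.2 = 0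
    · simp [vecMul, g, h]
    · simp [vecMul, g, h]
  have h1 : hammingNorm (x ᵥ* g.submatrix id e.symm) = hammingNorm (x ᵥ* g) := by
    refine Finset.card_equiv e.symm fun j => ?_
    simp only [Finset.mem_filter, Finset.mem_univ, true_and]
    rfl
  rw [h1, hammingNorm, Finset.card_filter, Fintype.sum_sigma]
  refine Finset.sum_congr rfl fun y _ => ?_
  rw [Fintype.sum_prod_type]
  simp only [hg, commonSupport, Finset.card_filter, Finset.sum_const, Finset.card_univ,
    Fintype.card_fin, smul_eq_mul]
  congr 1
  refine Finset.sum_congr rfl fun c _ => ?_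
  by_cases h : y ⬝ᵥ c = 0 <;> simp [h]

end Counting

section Orbits

variable {K : Type*} [Field K] {k : ℕ}

/-- The orbit of `x` under the action of `H` and of the scalars. -/
def scalarOrbit (H : Subgroup (GL (Fin k) K)) (x : Fin k → K) : Set (Fin k → K) :=
  {y | ∃ B ∈ (H : Set (GL (Fin k) K)), ∃ u : Kˣ, y = (u : K) • x ᵥ* (B : Matrix (Fin k) (Fin k) K)}

variable (H : Subgroup (GL (Fin k) K))

theorem mem_scalarOrbit_self (x : Fin k → K) : x ∈ scalarOrbit H x :=
  ⟨1, H.one_mem, 1, by simp⟩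

variable {H}

theorem scalarOrbit_subset {x y : Fin k → K} (h : y ∈ scalarOrbit H x) :
    scalarOrbit H y ⊆ scalarOrbit H x := by
  obtain ⟨B, hB, u, rfl⟩ := h
  rintro _ ⟨B', hB', v, rfl⟩
  exact ⟨B * B', H.mul_mem hB hB', v * u, by simp [smul_vecMul, smul_smul]⟩

theorem mem_scalarOrbit_symm {x y : Fin k → K} (h : y ∈ scalarOrbit H x) :
    x ∈ scalarOrbit H y := by
  obtain ⟨B, hB, u, rfl⟩ := h
  refine ⟨B⁻¹, H.inv_mem hB, u⁻¹, ?_⟩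
  rw [smul_vecMul, vecMul_vecMul, ← Units.val_mul, mul_inv_cancel]
  simp [smul_smul]

theorem scalarOrbit_eq {x y : Fin k → K} (h : y ∈ scalarOrbit H x) :
    scalarOrbit H y = scalarOrbit H x :=
  (scalarOrbit_subset h).antisymm (scalarOrbit_subset (mem_scalarOrbit_symm h))

theorem ClosedO.mem_of_scalarOrbit_vecMul (hH : ClosedO (H : Set (GL (Fin k) K)))
    (g : GL (Fin k) K)
    (hg : ∀ x, scalarOrbit H (x ᵥ* (g : Matrix (Fin k) (Fin k) K)) = scalarOrbit H x) :
    g ∈ H := by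
  refine (hH g).1 fun x => ?_
  change _ = scalarOrbit H x
  ext y
  constructor
  · rintro ⟨B, hB, u, rfl⟩
    have h1 : x ᵥ* (B : Matrix (Fin k) (Fin k) K) ∈ scalarOrbit H x := ⟨B, hB, 1, by simp⟩
    rw [← scalarOrbit_eq h1, ← hg]
    exact ⟨1, H.one_mem, u, by simp⟩
  · intro hy
    have hz : (y ᵥ* ((g⁻¹ : GL (Fin k) K) : Matrix (Fin k) (Fin k) K)) ᵥ*
        (g : Matrix (Fin k) (Fin k) K) = y := by
      rw [vecMul_vecMul, ← Units.val_mul, inv_mul_cancel]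
      simp
    have h1 := mem_scalarOrbit_self H (y ᵥ* ((g⁻¹ : GL (Fin k) K) : Matrix (Fin k) (Fin k) K))
    rw [← hg, hz, scalarOrbit_eq hy] at h1
    obtain ⟨B, hB, u, h⟩ := h1
    refine ⟨B, hB, u, ?_⟩
    rw [← hz, h, smul_vecMul, vecMul_vecMul]

theorem exists_linearCode_of_closedO [Fintype K] [DecidableEq K]
    (hH : ClosedO (H : Set (GL (Fin k) K))) :
    ∃ (n : ℕ) (g : Matrix (Fin k) (Fin n) K),
      (∀ x : Fin k → K, x ᵥ* g = 0 → x = 0) ∧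
      ∀ B : GL (Fin k) K, (∀ x : Fin k → K,
        hammingNorm ((x ᵥ* (B : Matrix (Fin k) (Fin k) K)) ᵥ* g) = hammingNorm (x ᵥ* g)) ↔
          B ∈ H := by
  classical
  let f : (Fin k → K) → ℕ := fun x => Fintype.equivFin (Set (Fin k → K)) (scalarOrbit H x) + 1
  have hf : ∀ x y, f x = f y ↔ scalarOrbit H x = scalarOrbit H y := by
    intro x y
    simp [f, Fin.val_inj]
  obtain ⟨n, g, hg⟩ := exists_hammingNorm_vecMul f
  obtain ⟨A, D, hD, hAD⟩ := sum_commonSupport f fun u x =>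
    (hf _ _).2 (scalarOrbit_eq ⟨1, H.one_mem, u, by simp⟩)
  have hpos : 0 < Fintype.card K * Fintype.card K := Nat.mul_pos Fintype.card_pos Fintype.card_pos
  have hinj : ∀ (B : GL (Fin k) K) (x : Fin k → K),
      x ≠ 0 → x ᵥ* (B : Matrix (Fin k) (Fin k) K) ≠ 0 := by
    intro B x hx h
    apply hx
    have := congrArg (· ᵥ* ((B⁻¹ : GL (Fin k) K) : Matrix (Fin k) (Fin k) K)) h
    simpa only [vecMul_vecMul, ← Units.val_mul, mul_inv_cancel, Units.val_one, vecMul_one,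
      zero_vecMul] using this
  refine ⟨n, g, fun x hx => ?_, fun B => ⟨fun h => ?_, fun hB x => ?_⟩⟩
  · by_contra hx0
    have h1 := hAD x hx0
    rw [← hg, hx, hammingNorm_zero, zero_mul] at h1
    have : 0 < D * f x := Nat.mul_pos hD (Nat.succ_pos _)
    omega
  · refine hH.mem_of_scalarOrbit_vecMul B fun x => ?_
    rcases eq_or_ne x 0 with rfl | hx
    · simp
    · have h1 := hAD x hx
      have h2 := hAD _ (hinj B x hx)
      rw [← hg] at h1 h2
      rw [h x, h1] at h2
      exact ((hf _ _).1 (Nat.eq_of_mul_eq_mul_left hD (Nat.add_left_cancel h2))).symm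
  · rcases eq_or_ne x 0 with rfl | hx
    · simp
    · have h1 := hAD x hx
      have h2 := hAD _ (hinj B x hx)
      rw [(hf _ x).2 (scalarOrbit_eq ⟨B, hB, 1, by simp⟩), ← h1] at h2
      rw [hg, hg]
      exact Nat.eq_of_mul_eq_mul_right hpos h2

end Orbits

section Socle

open IsLocalRing

variable {R : Type*} [CommRing R] [IsLocalRing R]

theorem IsLocalRing.annihilator_maximalIdeal_ne_bot [IsArtinianRing R] :
    Submodule.annihilator (maximalIdeal R) ≠ ⊥ := by
  classical
  intro h
  have hn : ∃ n, maximalIdeal R ^ n = 0 :=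
    (isArtinianRing_iff_isNilpotent_maximalIdeal R).1 inferInstance
  have h0 : Nat.find hn ≠ 0 := by
    intro h0
    have := Nat.find_spec hn
    rw [h0, pow_zero] at this
    exact one_ne_zero this
  obtain ⟨n, hn'⟩ := Nat.exists_eq_succ_of_ne_zero h0
  have hs := Nat.find_spec hn
  rw [hn', pow_succ] at hs
  refine Nat.find_min hn (m := n) (by omega) ?_
  rw [Submodule.zero_eq_bot, eq_bot_iff, ← h]
  intro x hx
  rw [Submodule.mem_annihilator]
  intro y hy
  have := Ideal.mul_mem_mul hx hy
  rw [hs] at this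
  exact this

theorem IsLocalRing.mul_generator_socle_eq_iff [IsArtinianRing R] {α : R}
    (hα : Ideal.span {α} = Submodule.annihilator (maximalIdeal R)) (a b : R) :
    α * a = α * b ↔
      Ideal.Quotient.mk (maximalIdeal R) a = Ideal.Quotient.mk (maximalIdeal R) b := by
  rw [Ideal.Quotient.eq, ← sub_eq_zero, ← mul_sub]
  constructor
  · intro h hu
    have h0 : α = 0 := by
      rwa [mul_comm, hu.mul_right_eq_zero] at h
    apply annihilator_maximalIdeal_ne_bot (R := R)
    rw [← hα, h0, Ideal.span_singleton_eq_bot]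
  · intro h
    have : α ∈ Submodule.annihilator (maximalIdeal R) := hα ▸ Ideal.mem_span_singleton_self α
    exact Submodule.mem_annihilator.1 this _ h

theorem IsLocalRing.sum_lift_mul_eq [IsArtinianRing R] {α : R}
    (hα : Ideal.span {α} = Submodule.annihilator (maximalIdeal R)) {k : ℕ}
    {l l' : R ⧸ maximalIdeal R → R}
    (hl : ∀ c, Ideal.Quotient.mk (maximalIdeal R) (l c) = c)
    (hl' : ∀ c, Ideal.Quotient.mk (maximalIdeal R) (l' c) = c)
    (x y : Fin k → R ⧸ maximalIdeal R) :
    ∑ i, l (x i) * (α * l' (y i)) = α * l' (x ⬝ᵥ y) := by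
  have h : ∑ i, l (x i) * (α * l' (y i)) = α * ∑ i, l (x i) * l' (y i) := by
    rw [Finset.mul_sum]
    exact Finset.sum_congr rfl fun i _ => by ring
  rw [h, mul_generator_socle_eq_iff hα]
  simp [hl, hl', dotProduct]

end Socle

/-- Let `R` be a finite commutative local Frobenius ring with maximal
ideal `m`, residue field `F_q = R/m` and socle `soc(R) = ann(m) = αR`.  If
`H ≤ GL_k(F_q)` is closed for the right action on `O`, then there are `n` and a
stabilizer code `C ⊆ (αR)^{2n} ⊆ R^{2n}` — the `F_q`-row space (via any lift of `R/m`
to `R`, the scalar action `r̄ · x = r x` on `αR` being well defined) of a `k`-row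
matrix `G'` with entries in `αR`, a self-orthogonal `R`-submodule on which the encoding
is injective — whose group of symplectic isometries
`{B ∈ GL_k(F_q) : wt_s(xBG') = wt_s(xG') ∀x}` equals `H`. -/
theorem stmt14 {R : Type*} [CommRing R] [Fintype R] [DecidableEq R] [IsLocalRing R]
    (χ : AddChar R ℂ) (hχ : IsGenChar χ) (α : R)
    (hα : Ideal.span {α} = Submodule.annihilator (IsLocalRing.maximalIdeal R))
    {k : ℕ}
    (H : Subgroup (Matrix.GeneralLinearGroup (Fin k) (R ⧸ IsLocalRing.maximalIdeal R)))
    (hH : ClosedO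
      (H : Set (Matrix.GeneralLinearGroup (Fin k) (R ⧸ IsLocalRing.maximalIdeal R)))) :
    ∃ (n : ℕ) (G' : Matrix (Fin k) (Fin n × Fin 2) R),
      (∀ i j, G' i j ∈ Ideal.span {α}) ∧
      ∀ lift : (R ⧸ IsLocalRing.maximalIdeal R) → R,
        (∀ c, Ideal.Quotient.mk (IsLocalRing.maximalIdeal R) (lift c) = c) →
        (Function.Injective
          (fun (x : Fin k → R ⧸ IsLocalRing.maximalIdeal R) (j : Fin n × Fin 2) =>
            ∑ i, lift (x i) * G' i j)) ∧
        (∀ x y : Fin k → R ⧸ IsLocalRing.maximalIdeal R,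
          sympFormI (fun j => ∑ i, lift (x i) * G' i j)
            (fun j => ∑ i, lift (y i) * G' i j) = 0) ∧
        (∃ C : Submodule R (Fin n × Fin 2 → R),
          (C : Set (Fin n × Fin 2 → R)) =
            Set.range (fun (x : Fin k → R ⧸ IsLocalRing.maximalIdeal R)
              (j : Fin n × Fin 2) => ∑ i, lift (x i) * G' i j)) ∧
        {B : Matrix.GeneralLinearGroup (Fin k) (R ⧸ IsLocalRing.maximalIdeal R) |
          ∀ x : Fin k → R ⧸ IsLocalRing.maximalIdeal R,
            wtH (fun j => ∑ i,
              lift (Matrix.vecMul x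
                (B : Matrix (Fin k) (Fin k) (R ⧸ IsLocalRing.maximalIdeal R)) i) * G' i j) =
            wtH (fun j => ∑ i, lift (x i) * G' i j)} =
          (H : Set (Matrix.GeneralLinearGroup (Fin k) (R ⧸ IsLocalRing.maximalIdeal R))) := by
  classical
  let m := IsLocalRing.maximalIdeal R
  let : Field (R ⧸ m) := Ideal.Quotient.field m
  let : Fintype (R ⧸ m) := Fintype.ofFinite _
  obtain ⟨n, g, hg0, hgH⟩ := exists_linearCode_of_closedO (K := R ⧸ m) hH
  obtain ⟨s, hs⟩ := (Ideal.Quotient.mk_surjective (I := m)).hasRightInverse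
  have hα0 : ∀ c : R ⧸ m, α * s c = 0 ↔ c = 0 := by
    intro c
    rw [← mul_zero α, IsLocalRing.mul_generator_socle_eq_iff hα, hs, map_zero]
  refine ⟨n, fun i j => if j.2 = 0 then α * s (g i j.1) else 0, ?_, fun lift hlift => ?_⟩
  · intro i j
    dsimp only
    split_ifs
    · exact Ideal.mul_mem_right _ _ (Ideal.mem_span_singleton_self α)
    · exact Ideal.zero_mem _
  have hE : ∀ (x : Fin k → R ⧸ m) (j : Fin n × Fin 2),
      ∑ i, lift (x i) * (if j.2 = 0 then α * s (g i j.1) else 0) =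
        if j.2 = 0 then α * s ((x ᵥ* g) j.1) else 0 := by
    intro x j
    split_ifs
    · exact IsLocalRing.sum_lift_mul_eq hα hlift hs x fun i => g i j.1
    · simp
  have hwt : ∀ x : Fin k → R ⧸ m,
      wtH (fun j : Fin n × Fin 2 => if j.2 = 0 then α * s ((x ᵥ* g) j.1) else 0) =
        hammingNorm (x ᵥ* g) := by
    intro x
    simp [wtH, hammingNorm, hα0]
  simp only [hE, hwt]
  refine ⟨fun x y hxy => ?_, fun x y => ?_, ⟨{
      carrier := Set.range fun (x : Fin k → R ⧸ m) (j : Fin n × Fin 2) =>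
        if j.2 = 0 then α * s ((x ᵥ* g) j.1) else 0
      zero_mem' := ?_
      add_mem' := ?_
      smul_mem' := ?_ }, rfl⟩, ?_⟩
  · rw [← sub_eq_zero]
    apply hg0
    rw [sub_vecMul, sub_eq_zero]
    funext j
    have h := congrFun hxy (j, 0)
    simp only [if_true, IsLocalRing.mul_generator_socle_eq_iff hα] at h
    exact (hs _).symm.trans (h.trans (hs _))
  · simp [sympFormI]
  · rintro _ _ ⟨x, rfl⟩ ⟨y, rfl⟩
    refine ⟨x + y, funext fun j => ?_⟩
    simp only [Pi.add_apply]
    split_ifs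
    · rw [← mul_add, IsLocalRing.mul_generator_socle_eq_iff hα, map_add, hs, hs, hs, add_vecMul,
        Pi.add_apply]
    · simp
  · refine ⟨0, funext fun j => ?_⟩
    simp [hα0]
  · rintro r _ ⟨x, rfl⟩
    refine ⟨Ideal.Quotient.mk m r • x, funext fun j => ?_⟩
    simp only [Pi.smul_apply, smul_eq_mul]
    split_ifs
    · rw [mul_left_comm, IsLocalRing.mul_generator_socle_eq_iff hα, map_mul, hs, hs, smul_vecMul,
        Pi.smul_apply, smul_eq_mul]
    · simp
  · ext B
    exact hgH B
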